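/- Let A be a weighted geometric mean closed Archimedean Φ-algebra, let n ≥ 1, and let r₁, …, rₙ ∈ (0,1) satisfy r₁ + ⋯ + rₙ = 1. Then for all a₁, …, aₙ ∈ A⁺, ∏ₖ₌₁ⁿ aₖ^{rₖ} = △ₖ₌₁ⁿ (aₖ, rₖ), where each real power aₖ^{rₖ} is defined via the infimum formula. -/

import Mathlib

/-- The set whose infimum (when it exists) is the weighted geometric mean
`△ₖ₌₁ⁿ (fₖ, rₖ) = inf { Σₖ rₖ·θₖ·|fₖ| : θₖ ∈ (0,∞), ∏ₖ θₖ^{rₖ} = 1 }`. -/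
def wSet {E : Type*} [AddCommGroup E] [Lattice E] [Module ℝ E]
    (n : ℕ) (f : Fin n → E) (r : Fin n → ℝ) : Set E :=
  {x | ∃ θ : Fin n → ℝ, (∀ k, 0 < θ k) ∧ (∏ k, θ k ^ r k) = 1 ∧
      x = ∑ k, (r k * θ k) • |f k|}

/-- The set whose infimum gives the fractional part of the real power `a^r` in a
`Φ`-algebra with unit `1`: with `r̃ = r - ⌊r⌋`, this is
`{ r̃·θ₁·a + (1-r̃)·θ₂·e : θ₁, θ₂ ∈ (0,∞), θ₁^{r̃}·θ₂^{1-r̃} = 1 }`. -/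
def rpowSet {A : Type*} [CommRing A] [Lattice A] [Module ℝ A]
    (a : A) (r : ℝ) : Set A :=
  {x | ∃ θ₁ θ₂ : ℝ, 0 < θ₁ ∧ 0 < θ₂ ∧
      θ₁ ^ (r - (⌊r⌋₊ : ℝ)) * θ₂ ^ (1 - (r - (⌊r⌋₊ : ℝ))) = 1 ∧
      x = ((r - (⌊r⌋₊ : ℝ)) * θ₁) • a + ((1 - (r - (⌊r⌋₊ : ℝ))) * θ₂) • (1 : A)}

/-- `IsRPow a r b` says that `b = a^r` in the sense of Definition 4.3:
`a^r = a^{⌊r⌋} · inf (rpowSet a r)` (with `a^{⌊r⌋} = e` when `⌊r⌋ = 0`). -/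
def IsRPow {A : Type*} [CommRing A] [Lattice A] [Module ℝ A]
    (a : A) (r : ℝ) (b : A) : Prop :=
  ∃ c : A, IsGLB (rpowSet a r) c ∧ b = a ^ ⌊r⌋₊ * c


structure IsPre {A : Type*} [CommRing A] [Lattice A] (T : Set A) : Prop where
  nonneg : ∀ x : A, 0 ≤ x → x ∈ T
  add : ∀ x ∈ T, ∀ y ∈ T, x + y ∈ T
  mul : ∀ x ∈ T, ∀ y ∈ T, x * y ∈ T
  neg_one : (-1 : A) ∉ T

lemma pp_mul_np {A : Type*} [CommRing A] [Lattice A] [IsOrderedAddMonoid A]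
    (_hmulpos : ∀ a b : A, 0 ≤ a → 0 ≤ b → 0 ≤ a * b)
    (hfalg : ∀ a b c : A, a ⊓ b = 0 → 0 ≤ c → (c * a) ⊓ b = 0)
    (a b : A) (h : a ⊓ b = 0) : a * b = 0 := by
  have ha : 0 ≤ a := h ▸ inf_le_left
  have hb : 0 ≤ b := h ▸ inf_le_right
  have h1 := hfalg a b b h hb
  rw [inf_comm] at h1
  have h2 := hfalg b (b * a) a h1 ha
  rwa [mul_comm b a, inf_idem] at h2

lemma sq_nn {A : Type*} [CommRing A] [Lattice A] [IsOrderedAddMonoid A]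
    (hmulpos : ∀ a b : A, 0 ≤ a → 0 ≤ b → 0 ≤ a * b)
    (hfalg : ∀ a b c : A, a ⊓ b = 0 → 0 ≤ c → (c * a) ⊓ b = 0)
    (a : A) : 0 ≤ a * a := by
  have h := pp_mul_np hmulpos hfalg _ _ (posPart_inf_negPart_eq_zero a)
  have e : a * a = a⁺ * a⁺ + a⁻ * a⁻ := by
    conv_lhs => rw [← posPart_sub_negPart a]
    linear_combination (-2) * h
  rw [e]
  exact add_nonneg (hmulpos _ _ (posPart_nonneg a) (posPart_nonneg a))
    (hmulpos _ _ (negPart_nonneg a) (negPart_nonneg a))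

/-- Extending a preordering to a total one. -/
lemma exists_total {A : Type*} [CommRing A] [Lattice A]
    (hsq : ∀ a : A, 0 ≤ a * a) (T₀ : Set A) (h₀ : IsPre T₀) :
    ∃ T : Set A, T₀ ⊆ T ∧ IsPre T ∧ ∀ y, y ∈ T ∨ -y ∈ T := by
  obtain ⟨T, hT0, hT⟩ := zorn_subset_nonempty {T : Set A | IsPre T} (by
    intro c hc hchain hne
    refine ⟨⋃₀ c, ?_, fun s hs => Set.subset_sUnion_of_mem hs⟩
    have key : ∀ x ∈ ⋃₀ c, ∀ y ∈ ⋃₀ c, ∃ s ∈ c, x ∈ s ∧ y ∈ s := by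
      rintro x ⟨s, hs, hx⟩ y ⟨t, ht, hy⟩
      rcases hchain.total hs ht with h | h
      · exact ⟨t, ht, h hx, hy⟩
      · exact ⟨s, hs, hx, h hy⟩
    constructor
    · intro x hx
      obtain ⟨s, hs⟩ := hne
      exact ⟨s, hs, (hc hs).nonneg x hx⟩
    · intro x hx y hy
      obtain ⟨s, hs, h1, h2⟩ := key x hx y hy
      exact ⟨s, hs, (hc hs).add x h1 y h2⟩
    · intro x hx y hy
      obtain ⟨s, hs, h1, h2⟩ := key x hx y hy
      exact ⟨s, hs, (hc hs).mul x h1 y h2⟩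
    · rintro ⟨s, hs, h⟩
      exact (hc hs).neg_one h) T₀ h₀
  have hp : IsPre T := hT.prop
  refine ⟨T, hT0, hp, ?_⟩
  have one_mem : (1 : A) ∈ T := hp.nonneg 1 (by simpa using hsq 1)
  have zero_mem : (0 : A) ∈ T := hp.nonneg 0 le_rfl
  have ext : ∀ y, y ∉ T → ∃ s ∈ T, ∃ t ∈ T, (-1 : A) = s + y * t := by
    intro y hy
    by_contra hcon
    push Not at hcon
    apply hy
    have hs : IsPre {x : A | ∃ s ∈ T, ∃ t ∈ T, x = s + y * t} := by
      constructor
      · intro x hx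
        exact ⟨x, hp.nonneg x hx, 0, zero_mem, by simp⟩
      · rintro _ ⟨s, hs, t, ht, rfl⟩ _ ⟨s', hs', t', ht', rfl⟩
        exact ⟨s + s', hp.add _ hs _ hs', t + t', hp.add _ ht _ ht', by ring⟩
      · rintro _ ⟨s, hs, t, ht, rfl⟩ _ ⟨s', hs', t', ht', rfl⟩
        exact ⟨s * s' + (y * y) * (t * t'), hp.add _ (hp.mul _ hs _ hs') _
          (hp.mul _ (hp.nonneg _ (hsq y)) _ (hp.mul _ ht _ ht')),
          s * t' + t * s', hp.add _ (hp.mul _ hs _ ht') _ (hp.mul _ ht _ hs'), by ring⟩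
      · rintro ⟨s, hs, t, ht, h⟩
        exact hcon s hs t ht h
    have hle : T ⊆ {x : A | ∃ s ∈ T, ∃ t ∈ T, x = s + y * t} :=
      fun x hx => ⟨x, hx, 0, zero_mem, by simp⟩
    exact hT.le_of_ge hs hle ⟨0, zero_mem, 1, one_mem, by simp⟩
  intro y
  by_contra hcon
  push Not at hcon
  obtain ⟨s, hs, t, ht, e⟩ := ext y hcon.1
  obtain ⟨s', hs', t', ht', e'⟩ := ext (-y) hcon.2
  apply hp.neg_one
  have : (-1 : A) = s + s' + s * s' + (y * y) * (t * t') := by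
    linear_combination (1 + s') * e + (-y * t) * e'
  rw [this]
  exact hp.add _ (hp.add _ (hp.add _ hs _ hs') _ (hp.mul _ hs _ hs')) _
    (hp.mul _ (hp.nonneg _ (hsq y)) _ (hp.mul _ ht _ ht'))

/-- Points: enough total preorderings at which `u` is finite and `x` is not infinitesimal. -/
lemma exists_point {A : Type*} [CommRing A] [Lattice A] [IsOrderedAddMonoid A]
    [Algebra ℝ A] [PosSMulMono ℝ A]
    (harch : ∀ f g : A, (∀ n : ℕ, (n : ℝ) • f ≤ g) → f ≤ 0)
    (hmulpos : ∀ a b : A, 0 ≤ a → 0 ≤ b → 0 ≤ a * b)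
    (hfalg : ∀ a b c : A, a ⊓ b = 0 → 0 ≤ c → (c * a) ⊓ b = 0)
    (u x : A) (hu : 0 ≤ u) (hx : ¬ x ≤ 0) :
    ∃ T : Set A, IsPre T ∧ (∀ y, y ∈ T ∨ -y ∈ T) ∧
      (∃ ε : ℝ, 0 < ε ∧ x - algebraMap ℝ A ε ∈ T) ∧ (∃ K : ℝ, algebraMap ℝ A K - u ∈ T) := by
  have hsq := sq_nn hmulpos hfalg
  have h1 : (0 : A) ≤ 1 := by simpa using hsq 1
  have hxp : x⁺ ≠ 0 := fun h => hx (posPart_eq_zero.1 h)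
  set z := x⁺ ⊓ 1 with hz
  have hz0 : 0 ≤ z := le_inf (posPart_nonneg x) h1
  have hzne : ¬ z ≤ 0 := by
    intro h
    have h' : x⁺ ⊓ 1 = 0 := le_antisymm h hz0
    have := pp_mul_np hmulpos hfalg _ _ h'
    exact hxp (by simpa using this)
  obtain ⟨N, hN⟩ : ∃ N : ℕ, ¬ (N : ℝ) • z ≤ 1 + u := by
    by_contra hcon
    push Not at hcon
    exact hzne (harch z (1 + u) hcon)
  have hNpos : 0 < (N : ℝ) := by
    rcases Nat.eq_zero_or_pos N with h | h
    · subst h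
      exact absurd (by simpa using add_nonneg h1 hu) hN
    · exact_mod_cast h
  set g := (N : ℝ) • z - (1 + u) with hg
  have hgp : g⁺ ≠ 0 := fun h => hN (by simpa [hg] using posPart_eq_zero.1 h)
  have hgg := pp_mul_np hmulpos hfalg _ _ (posPart_inf_negPart_eq_zero g)
  have hpre : IsPre {y : A | ∃ s t : A, 0 ≤ s ∧ 0 ≤ t ∧ y = s + g * t} := by
    constructor
    · intro y hy
      exact ⟨y, 0, hy, le_rfl, by simp⟩
    · rintro _ ⟨s, t, hs, ht, rfl⟩ _ ⟨s', t', hs', ht', rfl⟩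
      exact ⟨s + s', t + t', add_nonneg hs hs', add_nonneg ht ht', by ring⟩
    · rintro _ ⟨s, t, hs, ht, rfl⟩ _ ⟨s', t', hs', ht', rfl⟩
      exact ⟨s * s' + (g * g) * (t * t'), s * t' + t * s',
        add_nonneg (hmulpos _ _ hs hs') (hmulpos _ _ (hsq g) (hmulpos _ _ ht ht')),
        add_nonneg (hmulpos _ _ hs ht') (hmulpos _ _ ht hs'), by ring⟩
    · rintro ⟨s, t, hs, ht, e⟩
      apply hgp
      have e2 : -g⁺ = g⁺ * s + (g⁺ * g⁺) * t := by
        have e3 : g = g⁺ - g⁻ := (posPart_sub_negPart g).symm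
        have e4 : g⁺ * g = g⁺ * g⁺ := by
          linear_combination g⁺ * e3 - hgg
        linear_combination g⁺ * e + t * e4
      have h5 : 0 ≤ -g⁺ := by
        rw [e2]
        exact add_nonneg (hmulpos _ _ (posPart_nonneg g) hs) (hmulpos _ _ (hsq _) ht)
      exact le_antisymm (by simpa using h5) (posPart_nonneg g)
  obtain ⟨T, hT0, hT, htot⟩ := exists_total hsq _ hpre
  have hgT : g ∈ T := hT0 ⟨0, 1, le_rfl, h1, by simp⟩
  have hnn : ∀ c : ℝ, 0 ≤ c → (algebraMap ℝ A c) ∈ T := fun c hc =>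
    hT.nonneg _ (by rw [Algebra.algebraMap_eq_smul_one]; exact smul_nonneg hc h1)
  refine ⟨T, hT, htot, ⟨(N : ℝ)⁻¹, by positivity, ?_⟩, ⟨N, ?_⟩⟩
  · have hxN : x⁺ - algebraMap ℝ A (N : ℝ)⁻¹ ∈ T := by
      have e : x⁺ - algebraMap ℝ A (N : ℝ)⁻¹ =
          (x⁺ - z) + algebraMap ℝ A (N : ℝ)⁻¹ * (g + u) := by
        have : algebraMap ℝ A (N : ℝ)⁻¹ * algebraMap ℝ A (N : ℝ) = 1 := by
          rw [← map_mul, inv_mul_cancel₀ hNpos.ne', map_one]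
        rw [hg, Algebra.smul_def]
        linear_combination (-z) * this
      rw [e]
      exact hT.add _ (hT.nonneg _ (sub_nonneg.2 inf_le_left)) _
        (hT.mul _ (hnn _ (by positivity)) _ (hT.add _ hgT _ (hT.nonneg _ hu)))
    have hxx := pp_mul_np hmulpos hfalg _ _ (posPart_inf_negPart_eq_zero x)
    have hneg : -x⁻ ∈ T := by
      have : -x⁻ = algebraMap ℝ A (N : ℝ) * (x⁻ * (x⁺ - algebraMap ℝ A (N : ℝ)⁻¹)) := by
        have : algebraMap ℝ A (N : ℝ)⁻¹ * algebraMap ℝ A (N : ℝ) = 1 := by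
          rw [← map_mul, inv_mul_cancel₀ hNpos.ne', map_one]
        linear_combination (x⁻) * this - algebraMap ℝ A (N : ℝ) * hxx
      rw [this]
      exact hT.mul _ (hnn _ hNpos.le) _ (hT.mul _ (hT.nonneg _ (negPart_nonneg x)) _ hxN)
    have e : x - algebraMap ℝ A (N : ℝ)⁻¹ = (x⁺ - algebraMap ℝ A (N : ℝ)⁻¹) + -x⁻ := by
      conv_lhs => rw [← posPart_sub_negPart x]
      ring
    rw [e]
    exact hT.add _ hxN _ hneg
  · have e : algebraMap ℝ A (N : ℝ) - u = algebraMap ℝ A (N : ℝ) * (1 - z) + g + 1 := by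
      rw [hg, Algebra.smul_def]; ring
    rw [e]
    exact hT.add _ (hT.add _ (hT.mul _ (hnn _ hNpos.le) _
      (hT.nonneg _ (sub_nonneg.2 inf_le_right))) _ hgT) _ (hT.nonneg _ h1)

/-- `y` is infinitely close to the real `t` with respect to `T`. -/
def St {A : Type*} [CommRing A] [Algebra ℝ A] (T : Set A) (y : A) (t : ℝ) : Prop :=
  ∀ ε : ℝ, 0 < ε → algebraMap ℝ A ε - (y - algebraMap ℝ A t) ∈ T ∧
    algebraMap ℝ A ε + (y - algebraMap ℝ A t) ∈ T

section St
variable {A : Type*} [CommRing A] [Lattice A] [Algebra ℝ A] {T : Set A}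

lemma St.add (hT : IsPre T) {y y' : A} {t t' : ℝ} (h : St T y t) (h' : St T y' t') :
    St T (y + y') (t + t') := by
  intro ε hε
  obtain ⟨h1, h2⟩ := h (ε / 2) (by positivity)
  obtain ⟨h3, h4⟩ := h' (ε / 2) (by positivity)
  have e : algebraMap ℝ A ε = algebraMap ℝ A (ε / 2) + algebraMap ℝ A (ε / 2) := by
    rw [← map_add]; congr 1; ring
  constructor
  · convert hT.add _ h1 _ h3 using 1
    rw [e, map_add]; ring
  · convert hT.add _ h2 _ h4 using 1
    rw [e, map_add]; ring

lemma St.neg {y : A} {t : ℝ} (h : St T y t) : St T (-y) (-t) := by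
  intro ε hε
  obtain ⟨h1, h2⟩ := h ε hε
  constructor
  · convert h2 using 1
    rw [map_neg]; ring
  · convert h1 using 1
    rw [map_neg]; ring

lemma St.sub (hT : IsPre T) {y y' : A} {t t' : ℝ} (h : St T y t) (h' : St T y' t') :
    St T (y - y') (t - t') := by
  rw [sub_eq_add_neg, sub_eq_add_neg]; exact St.add hT h h'.neg

lemma st_const (hR : ∀ c : ℝ, 0 ≤ c → (algebraMap ℝ A c) ∈ T) (t : ℝ) :
    St T (algebraMap ℝ A t) t := by
  intro ε hε
  simpa using hR ε hε.le

lemma St.smul (hT : IsPre T) (hR : ∀ c : ℝ, 0 ≤ c → (algebraMap ℝ A c) ∈ T)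
    {y : A} {t : ℝ} (c : ℝ) (h : St T y t) : St T (c • y) (c * t) := by
  have pos : ∀ c : ℝ, 0 < c → St T (c • y) (c * t) := by
    intro c hc ε hε
    obtain ⟨h1, h2⟩ := h (ε / c) (by positivity)
    have e : algebraMap ℝ A ε = algebraMap ℝ A c * algebraMap ℝ A (ε / c) := by
      rw [← map_mul]; congr 1; field_simp
    constructor
    · convert hT.mul _ (hR c hc.le) _ h1 using 1
      rw [e, map_mul, Algebra.smul_def]; ring
    · convert hT.mul _ (hR c hc.le) _ h2 using 1
      rw [e, map_mul, Algebra.smul_def]; ring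
  rcases lt_trichotomy c 0 with h0 | h0 | h0
  · simpa using (pos (-c) (by linarith)).neg
  · subst h0
    simpa using st_const hR 0
  · exact pos c h0

lemma St.mul (hT : IsPre T) (hR : ∀ c : ℝ, 0 ≤ c → (algebraMap ℝ A c) ∈ T)
    {y y' : A} {t t' : ℝ} (h : St T y t) (h' : St T y' t') :
    St T (y * y') (t * t') := by
  have key : St T ((y - algebraMap ℝ A t) * (y' - algebraMap ℝ A t')) 0 := by
    intro ε hε
    obtain ⟨h1, h2⟩ := h ε hε
    obtain ⟨h3, h4⟩ := h' 1 one_pos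
    have hh := hR (1 / 2) (by norm_num)
    have e : algebraMap ℝ A (1 / 2) * 2 = 1 := by
      have : (2 : A) = algebraMap ℝ A 2 := (map_ofNat (algebraMap ℝ A) 2).symm
      rw [this, ← map_mul]; norm_num
    rw [map_one] at h3 h4
    rw [map_zero, sub_zero]
    generalize y - algebraMap ℝ A t = i at *
    generalize y' - algebraMap ℝ A t' = j at *
    generalize algebraMap ℝ A (1 / 2) = c at *
    generalize algebraMap ℝ A ε = d at *
    constructor
    · convert hT.mul _ hh _ (hT.add _ (hT.mul _ h1 _ h4) _ (hT.mul _ h2 _ h3)) using 1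
      linear_combination (-(d - i * j)) * e
    · convert hT.mul _ hh _ (hT.add _ (hT.mul _ h1 _ h3) _ (hT.mul _ h2 _ h4)) using 1
      linear_combination (-(d + i * j)) * e
  have h5 := St.add hT key (St.add hT (h'.smul hT hR t)
    (St.add hT (h.smul hT hR t') (st_const hR (-(t * t')))))
  convert h5 using 1
  · simp only [Algebra.smul_def, map_neg, map_mul]; ring
  · ring

lemma St.le (hT : IsPre T) (hR : ∀ c : ℝ, 0 ≤ c → (algebraMap ℝ A c) ∈ T)
    {y y' : A} {t t' : ℝ} (h : St T y t) (h' : St T y' t') (hle : y' - y ∈ T) :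
    t ≤ t' := by
  by_contra hcon
  push Not at hcon
  have h0 := (h'.sub hT h ((t - t') / 2) (by linarith)).1
  have h1 := hT.add _ hle _ h0
  apply hT.neg_one
  have h2 := hT.mul _ (hR (2 / (t - t')) (div_nonneg (by norm_num) (by linarith))) _ h1
  convert h2 using 1
  have : y' - y + (algebraMap ℝ A ((t - t') / 2) - (y' - y - algebraMap ℝ A (t' - t)))
    = algebraMap ℝ A (-((t - t') / 2)) := by
    have e : algebraMap ℝ A (-((t - t') / 2)) =
      algebraMap ℝ A ((t - t') / 2) + algebraMap ℝ A (t' - t) := by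
      rw [← map_add]; congr 1; ring
    rw [e]; ring
  rw [this, ← map_mul]
  have h3 : t - t' ≠ 0 := by linarith
  have : 2 / (t - t') * -((t - t') / 2) = -1 := by field_simp
  rw [this]; simp

lemma st_exists (hT : IsPre T) (htot : ∀ y, y ∈ T ∨ -y ∈ T)
    (hR : ∀ c : ℝ, 0 ≤ c → (algebraMap ℝ A c) ∈ T) {y : A} (h0 : y ∈ T) (K : ℝ)
    (hK : algebraMap ℝ A K - y ∈ T) : ∃ t, St T y t := by
  set S : Set ℝ := {q | y - algebraMap ℝ A q ∈ T} with hS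
  have hne : S.Nonempty := ⟨0, by simpa [hS] using h0⟩
  have hbd : BddAbove S := by
    refine ⟨K, fun q hq => ?_⟩
    refine St.le hT hR (st_const hR q) (st_const hR K) ?_
    convert hT.add _ hq _ hK using 1
    ring
  refine ⟨sSup S, fun ε hε => ⟨?_, ?_⟩⟩
  · have : sSup S + ε ∉ S := fun h => by
      have := le_csSup hbd h
      linarith
    have h2 := (htot (y - algebraMap ℝ A (sSup S + ε))).resolve_left this
    convert h2 using 1
    rw [map_add]; ring
  · obtain ⟨q, hq, hlt⟩ := exists_lt_of_lt_csSup hne (show sSup S - ε < sSup S by linarith)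
    have := hT.add _ hq _ (hR (q - (sSup S - ε)) (by linarith))
    convert this using 1
    simp only [map_sub]; ring

lemma st_sum (hT : IsPre T) (hR : ∀ c : ℝ, 0 ≤ c → (algebraMap ℝ A c) ∈ T)
    {ι : Type*} (s : Finset ι) (y : ι → A) (t : ι → ℝ) (h : ∀ k, St T (y k) (t k)) :
    St T (∑ k ∈ s, y k) (∑ k ∈ s, t k) := by
  classical
  induction s using Finset.induction_on with
  | empty => simpa using st_const hR 0
  | insert k s hk ih =>
    rw [Finset.sum_insert hk, Finset.sum_insert hk]; exact St.add hT (h k) ih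

lemma st_prod (hT : IsPre T) (hR : ∀ c : ℝ, 0 ≤ c → (algebraMap ℝ A c) ∈ T)
    {ι : Type*} (s : Finset ι) (y : ι → A) (t : ι → ℝ) (h : ∀ k, St T (y k) (t k)) :
    St T (∏ k ∈ s, y k) (∏ k ∈ s, t k) := by
  classical
  induction s using Finset.induction_on with
  | empty => simpa using st_const hR 1
  | insert k s hk ih =>
    rw [Finset.prod_insert hk, Finset.prod_insert hk]; exact St.mul hT hR (h k) ih

end St

lemma le_wgeom {n : ℕ} (r t : Fin n → ℝ) (hr : ∀ k, 0 < r k) (hr1 : ∑ k, r k = 1)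
    (ht : ∀ k, 0 ≤ t k) (μ : ℝ)
    (h : ∀ θ : Fin n → ℝ, (∀ k, 0 < θ k) → (∏ k, θ k ^ r k) = 1 → μ ≤ ∑ k, r k * θ k * t k) :
    μ ≤ ∏ k, t k ^ r k := by
  have h1 : ∀ δ : ℝ, 0 < δ → μ ≤ ∏ k, (t k + δ) ^ r k := by
    intro δ hδ
    have hp : ∀ k, 0 < t k + δ := fun k => add_pos_of_nonneg_of_pos (ht k) hδ
    set G := ∏ k, (t k + δ) ^ r k with hG
    have hGpos : 0 < G := Finset.prod_pos fun k _ => Real.rpow_pos_of_pos (hp k) _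
    refine (h (fun k => G / (t k + δ)) (fun k => div_pos hGpos (hp k)) ?_).trans ?_
    · have : ∀ k, (G / (t k + δ)) ^ r k = G ^ r k / (t k + δ) ^ r k :=
        fun k => Real.div_rpow hGpos.le (hp k).le _
      simp only [this]
      rw [Finset.prod_div_distrib, ← hG, ← Real.rpow_sum_of_pos hGpos, hr1, Real.rpow_one,
        div_self hGpos.ne']
    · calc ∑ k, r k * (G / (t k + δ)) * t k ≤ ∑ k, r k * G := by
            apply Finset.sum_le_sum
            intro k _
            have : G / (t k + δ) * t k ≤ G := by
              rw [div_mul_eq_mul_div, div_le_iff₀ (hp k)]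
              nlinarith [ht k]
            rw [mul_assoc]
            exact mul_le_mul_of_nonneg_left this (hr k).le
        _ = G := by rw [← Finset.sum_mul, hr1, one_mul]
  have hcont : Continuous fun δ : ℝ => ∏ k, (t k + δ) ^ r k := by
    apply continuous_finsetProd
    intro k _
    exact (continuous_const.add continuous_id).rpow_const fun x => Or.inr (hr k).le
  have hlim : Filter.Tendsto (fun δ : ℝ => ∏ k, (t k + δ) ^ r k) (nhdsWithin 0 (Set.Ioi 0))
      (nhds (∏ k, t k ^ r k)) := by
    have := (hcont.tendsto 0).mono_left (nhdsWithin_le_nhds (s := Set.Ioi (0:ℝ)))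
    simpa using this
  exact ge_of_tendsto hlim (Filter.eventually_of_mem self_mem_nhdsWithin fun δ hδ => h1 δ hδ)

lemma st_pow_le {A : Type*} [CommRing A] [Lattice A] [IsOrderedAddMonoid A] [Algebra ℝ A]
    {T : Set A} (hT : IsPre T) (hR : ∀ c : ℝ, 0 ≤ c → (algebraMap ℝ A c) ∈ T)
    {a b : A} {t β r : ℝ} (hr : 0 < r ∧ r < 1) (ht : 0 ≤ t) (hat : St T a t) (hbt : St T b β)
    (h : ∀ θ₁ θ₂ : ℝ, 0 < θ₁ → 0 < θ₂ → θ₁ ^ r * θ₂ ^ (1 - r) = 1 →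
      b ≤ (r * θ₁) • a + ((1 - r) * θ₂) • (1 : A)) : β ≤ t ^ r := by
  have := le_wgeom ![r, 1 - r] ![t, 1] (by
      intro k; fin_cases k
      · exact hr.1
      · simpa using hr.2) (by simp [Fin.sum_univ_two]) (by
      intro k; fin_cases k
      · exact ht
      · simp) β (by
      intro θ hθ hprod
      simp only [Fin.prod_univ_two, Matrix.cons_val_zero, Matrix.cons_val_one] at hprod
      have h1 := h (θ 0) (θ 1) (hθ 0) (hθ 1) hprod
      have h2 := St.add hT (hat.smul hT hR (r * θ 0))
        ((st_const hR 1).smul hT hR ((1 - r) * θ 1))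
      rw [map_one] at h2
      have h3 := St.le hT hR hbt h2 (hT.nonneg _ (sub_nonneg.2 h1))
      simpa [Fin.sum_univ_two] using h3)
  simpa [Fin.prod_univ_two] using this

lemma le_st_pow {A : Type*} [CommRing A] [Lattice A] [IsOrderedAddMonoid A]
    [Algebra ℝ A] [PosSMulMono ℝ A]
    (hmulpos : ∀ a b : A, 0 ≤ a → 0 ≤ b → 0 ≤ a * b)
    (hfalg : ∀ a b c : A, a ⊓ b = 0 → 0 ≤ c → (c * a) ⊓ b = 0)
    {T : Set A} (hT : IsPre T) (htot : ∀ y, y ∈ T ∨ -y ∈ T)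
    (hR : ∀ c : ℝ, 0 ≤ c → (algebraMap ℝ A c) ∈ T)
    {a b : A} {t β r : ℝ} (hr : 0 < r ∧ r < 1) (ht : 0 ≤ t) (ha : 0 ≤ a)
    (hb0 : 0 ≤ b) (hat : St T a t) (hbt : St T b β)
    (h : ∀ d : A, (∀ θ₁ θ₂ : ℝ, 0 < θ₁ → 0 < θ₂ → θ₁ ^ r * θ₂ ^ (1 - r) = 1 →
      d ≤ (r * θ₁) • a + ((1 - r) * θ₂) • (1 : A)) → d ≤ b) : t ^ r ≤ β := by
  have h1 : (0 : A) ≤ 1 := by simpa using sq_nn hmulpos hfalg 1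
  rcases ht.eq_or_lt with h0 | h0
  · rw [← h0, Real.zero_rpow hr.1.ne']
    have h2 := st_const hR 0
    rw [map_zero] at h2
    exact St.le hT hR h2 hbt (hT.nonneg _ (by simpa using hb0))
  set e := (t⁻¹ • a) ⊓ 1 with he
  have hta : 0 ≤ t⁻¹ • a := smul_nonneg (by positivity) ha
  have he0 : 0 ≤ e := le_inf hta h1
  have he1 : e ≤ 1 := inf_le_right
  have hea : t • e ≤ a := by
    have : t • e ≤ t • (t⁻¹ • a) := smul_le_smul_of_nonneg_left inf_le_left h0.le
    rwa [smul_smul, mul_inv_cancel₀ h0.ne', one_smul] at this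
  -- standard part of `e`
  have hdisj : (t⁻¹ • a - e) ⊓ (1 - e) = 0 := by
    rw [← inf_sub, ← he, sub_self]
  have hprod := pp_mul_np hmulpos hfalg _ _ hdisj
  obtain ⟨η, hη⟩ := st_exists hT htot hR (hT.nonneg _ he0) 1
    (hT.nonneg _ (by simpa using he1))
  have hη1 : η = 1 := by
    have s1 := (hat.smul hT hR t⁻¹).sub hT hη
    have s2 := (st_const hR 1).sub hT hη
    rw [map_one] at s2
    have s3 := s1.mul hT hR s2
    rw [hprod, inv_mul_cancel₀ h0.ne'] at s3
    have s0 := st_const hR 0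
    rw [map_zero] at s0
    have s4 := St.le hT hR s3 s0 (hT.nonneg _ (by simp))
    nlinarith [sq_nonneg (1 - η)]
  subst hη1
  have hd : t ^ r • e ≤ b := by
    apply h
    intro θ₁ θ₂ hθ₁ hθ₂ hθ
    have amgm : t ^ r ≤ r * θ₁ * t + (1 - r) * θ₂ := by
      have := Real.geom_mean_le_arith_mean2_weighted hr.1.le (sub_nonneg.2 hr.2.le)
        (mul_nonneg hθ₁.le ht) hθ₂.le (by ring)
      rw [Real.mul_rpow hθ₁.le ht] at this
      have e2 : θ₁ ^ r * t ^ r * θ₂ ^ (1 - r) = t ^ r := by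
        linear_combination t ^ r * hθ
      rw [e2] at this
      linarith
    have k1 : t ^ r • e ≤ (r * θ₁ * t + (1 - r) * θ₂) • e := by
      rw [← sub_nonneg, ← sub_smul]
      exact smul_nonneg (sub_nonneg.2 amgm) he0
    refine k1.trans ?_
    rw [add_smul, mul_smul (r * θ₁) t e]
    exact add_le_add
      (smul_le_smul_of_nonneg_left hea (mul_nonneg hr.1.le hθ₁.le))
      (smul_le_smul_of_nonneg_left he1 (mul_nonneg (sub_nonneg.2 hr.2.le) hθ₂.le))
  have := St.le hT hR (hη.smul hT hR (t ^ r)) hbt (hT.nonneg _ (sub_nonneg.2 hd))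
  simpa using this

/-- **Lemma 4.6.** In a weighted geometric mean closed Archimedean `Φ`-algebra `A`, for
weights `r₁, …, rₙ ∈ (0,1)` with `Σₖ rₖ = 1` and `a₁, …, aₙ ∈ A⁺`,
`∏ₖ aₖ^{rₖ} = △ₖ₌₁ⁿ (aₖ, rₖ)`. -/
theorem stmt16 {A : Type*} [CommRing A] [Lattice A]
    [CovariantClass A A (· + ·) (· ≤ ·)]
    [Algebra ℝ A] [PosSMulMono ℝ A]
    (harch : ∀ f g : A, (∀ n : ℕ, (n : ℝ) • f ≤ g) → f ≤ 0)
    (hmulpos : ∀ a b : A, 0 ≤ a → 0 ≤ b → 0 ≤ a * b)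
    (hfalg : ∀ a b c : A, a ⊓ b = 0 → 0 ≤ c → (c * a) ⊓ b = 0)
    (hwgm : ∀ (n : ℕ) (f : Fin n → A) (r : Fin n → ℝ),
      (∀ k, 0 < r k ∧ r k < 1) → (∑ k, r k) = 1 → ∃ m, IsGLB (wSet n f r) m)
    (n : ℕ) (hn : 1 ≤ n)
    (r : Fin n → ℝ) (hr : ∀ k, 0 < r k ∧ r k < 1) (hr1 : (∑ k, r k) = 1)
    (a : Fin n → A) (ha : ∀ k, 0 ≤ a k)
    (b : Fin n → A) (hb : ∀ k, IsRPow (a k) (r k) (b k))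
    (m : A) (hm : IsGLB (wSet n a r) m) :
    (∏ k, b k) = m := by
  have : IsOrderedAddMonoid A :=
    { add_le_add_left := fun a b h c => by
        rw [add_comm a c, add_comm b c]
        exact CovariantClass.elim (μ := fun x y : A => x + y) c h }
  have h1 : (0 : A) ≤ 1 := by simpa using sq_nn hmulpos hfalg 1
  -- clean form of the hypotheses
  have hble : ∀ k, ∀ θ₁ θ₂ : ℝ, 0 < θ₁ → 0 < θ₂ → θ₁ ^ r k * θ₂ ^ (1 - r k) = 1 →
      b k ≤ (r k * θ₁) • a k + ((1 - r k) * θ₂) • (1 : A) := by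
    intro k θ₁ θ₂ hθ₁ hθ₂ hθ
    obtain ⟨c, hc, hbc⟩ := hb k
    have hf : ⌊r k⌋₊ = 0 := Nat.floor_eq_zero.2 (hr k).2
    rw [hf, pow_zero, one_mul] at hbc
    rw [hbc]
    apply hc.1
    refine ⟨θ₁, θ₂, hθ₁, hθ₂, ?_, ?_⟩
    · simpa [hf] using hθ
    · simp [hf]
  have hbge : ∀ k, ∀ d : A, (∀ θ₁ θ₂ : ℝ, 0 < θ₁ → 0 < θ₂ →
      θ₁ ^ r k * θ₂ ^ (1 - r k) = 1 →
      d ≤ (r k * θ₁) • a k + ((1 - r k) * θ₂) • (1 : A)) → d ≤ b k := by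
    intro k d hd
    obtain ⟨c, hc, hbc⟩ := hb k
    have hf : ⌊r k⌋₊ = 0 := Nat.floor_eq_zero.2 (hr k).2
    rw [hf, pow_zero, one_mul] at hbc
    rw [hbc]
    apply hc.2
    rintro _ ⟨θ₁, θ₂, hθ₁, hθ₂, hθ, rfl⟩
    simp only [hf, Nat.cast_zero, sub_zero] at hθ ⊢
    exact hd θ₁ θ₂ hθ₁ hθ₂ hθ
  have hmle : ∀ θ : Fin n → ℝ, (∀ k, 0 < θ k) → (∏ k, θ k ^ r k) = 1 →
      m ≤ ∑ k, (r k * θ k) • a k := by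
    intro θ hθ hp
    apply hm.1
    exact ⟨θ, hθ, hp, by simp only [abs_of_nonneg (ha _)]⟩
  have hmge : ∀ d : A, (∀ θ : Fin n → ℝ, (∀ k, 0 < θ k) → (∏ k, θ k ^ r k) = 1 →
      d ≤ ∑ k, (r k * θ k) • a k) → d ≤ m := by
    intro d hd
    apply hm.2
    rintro _ ⟨θ, hθ, hp, rfl⟩
    simp only [abs_of_nonneg (ha _)]
    exact hd θ hθ hp
  have hb0 : ∀ k, 0 ≤ b k := fun k => hbge k 0 fun θ₁ θ₂ h₁ h₂ _ =>
    add_nonneg (smul_nonneg (mul_nonneg (hr k).1.le h₁.le) (ha k))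
      (smul_nonneg (mul_nonneg (sub_nonneg.2 (hr k).2.le) h₂.le) h1)
  have hm0 : 0 ≤ m := hmge 0 fun θ hθ _ => Finset.sum_nonneg fun k _ =>
    smul_nonneg (mul_nonneg (hr k).1.le (hθ k).le) (ha k)
  have hsa : 0 ≤ ∑ k, a k := Finset.sum_nonneg fun k _ => ha k
  have hsb : 0 ≤ ∑ k, b k := Finset.sum_nonneg fun k _ => hb0 k
  set u := ∑ k, a k + ∑ k, b k + m with hu
  have hu0 : 0 ≤ u := add_nonneg (add_nonneg hsa hsb) hm0
  have hau : ∀ k, a k ≤ u := fun k =>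
    (Finset.single_le_sum (fun i _ => ha i) (Finset.mem_univ k)).trans
      ((le_add_of_nonneg_right hsb).trans (le_add_of_nonneg_right hm0))
  have hbu : ∀ k, b k ≤ u := fun k =>
    (Finset.single_le_sum (fun i _ => hb0 i) (Finset.mem_univ k)).trans
      ((le_add_of_nonneg_left hsa).trans (le_add_of_nonneg_right hm0))
  have hmu : m ≤ u := le_add_of_nonneg_left (add_nonneg hsa hsb)
  -- the evaluation principle
  have main : ∀ x : A, (∀ T : Set A, IsPre T → (∀ c : ℝ, 0 ≤ c → (algebraMap ℝ A c) ∈ T) →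
      ∀ t β : Fin n → ℝ, ∀ μ : ℝ, (∀ k, 0 ≤ t k) → (∀ k, St T (a k) (t k)) →
      (∀ k, St T (b k) (β k)) → St T m μ → (∀ k, β k = t k ^ r k) →
      ∃ ξ : ℝ, St T x ξ ∧ ξ ≤ 0) → x ≤ 0 := by
    intro x hx
    by_contra hcon
    obtain ⟨T, hT, htot, ⟨ε, hε, hxε⟩, ⟨K, hK⟩⟩ :=
      exists_point harch hmulpos hfalg u x hu0 hcon
    have hR : ∀ c : ℝ, 0 ≤ c → (algebraMap ℝ A c) ∈ T := fun c hc =>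
      hT.nonneg _ (by rw [Algebra.algebraMap_eq_smul_one]; exact smul_nonneg hc h1)
    have hex : ∀ y : A, 0 ≤ y → y ≤ u → ∃ t, St T y t := by
      intro y h0 hyu
      refine st_exists hT htot hR (hT.nonneg _ h0) K ?_
      convert hT.add _ hK _ (hT.nonneg _ (sub_nonneg.2 hyu)) using 1
      ring
    choose t ht using fun k => hex (a k) (ha k) (hau k)
    choose β hβ using fun k => hex (b k) (hb0 k) (hbu k)
    obtain ⟨μ, hμ⟩ := hex m hm0 hmu
    have s0 := st_const hR 0
    rw [map_zero] at s0
    have ht0 : ∀ k, 0 ≤ t k := fun k =>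
      St.le hT hR s0 (ht k) (hT.nonneg _ (by simpa using ha k))
    obtain ⟨ξ, hξ, hξ0⟩ := hx T hT hR t β μ ht0 ht hβ hμ fun k => le_antisymm
      (st_pow_le hT hR (hr k) (ht0 k) (ht k) (hβ k) (hble k))
      (le_st_pow hmulpos hfalg hT htot hR (hr k) (ht0 k) (ha k) (hb0 k) (ht k) (hβ k) (hbge k))
    have := St.le hT hR (st_const hR ε) hξ hxε
    linarith
  apply le_antisymm
  · apply hmge
    intro θ hθ hp
    rw [← sub_nonpos]
    apply main
    intro T hT hR t β μ ht0 ht hβ hμ e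
    refine ⟨_, (st_prod hT hR Finset.univ b β hβ).sub hT
      (st_sum hT hR Finset.univ _ _ fun k => (ht k).smul hT hR (r k * θ k)), ?_⟩
    have := Real.geom_mean_le_arith_mean_weighted Finset.univ r (fun k => θ k * t k)
      (fun k _ => (hr k).1.le) hr1 (fun k _ => mul_nonneg (hθ k).le (ht0 k))
    have e2 : ∏ k, (θ k * t k) ^ r k = ∏ k, β k := by
      simp only [Real.mul_rpow (hθ _).le (ht0 _), Finset.prod_mul_distrib, hp, one_mul, e]
    rw [e2] at this
    simp only [mul_assoc]
    linarith
  · rw [← sub_nonpos]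
    apply main
    intro T hT hR t β μ ht0 ht hβ hμ e
    refine ⟨_, hμ.sub hT (st_prod hT hR Finset.univ b β hβ), ?_⟩
    rw [sub_nonpos]
    simp only [e]
    refine le_wgeom r t (fun k => (hr k).1) hr1 ht0 μ fun θ hθ hp => ?_
    exact St.le hT hR hμ
      (st_sum hT hR Finset.univ _ _ fun k => (ht k).smul hT hR (r k * θ k))
      (hT.nonneg _ (sub_nonneg.2 (hmle θ hθ hp)))
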